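/- arXiv:0902.1608 — 3 statements merged into one kernel-verified Lean document; each statement's English description precedes it below -/
import Mathlib

section
/- For every n ≥ 1 and m ≥ 3, every edge-colouring of K_n with no monochromatic K_m and no rainbow K_4 uses at most n^(3/2)·√(2m) colours. Equivalently, maxAR(n, K_m, K_4) ≤ n^(3/2)·√(2m). -/
/-- No monochromatic complete subgraph on `m` vertices. -/
def NoMonoClique (n m : ℕ) (c : Sym2 (Fin n) → ℕ) : Prop :=
  ¬ ∃ S : Finset (Fin n), S.card = m ∧
      ∃ col, ∀ x ∈ S, ∀ y ∈ S, x ≠ y → c s(x, y) = col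

/-- No rainbow complete subgraph on 4 vertices. -/
def NoRainbowK4 (n : ℕ) (c : Sym2 (Fin n) → ℕ) : Prop :=
  ¬ ∃ S : Finset (Fin n), S.card = 4 ∧
      ∀ x ∈ S, ∀ y ∈ S, ∀ z ∈ S, ∀ w ∈ S,
        x ≠ y → z ≠ w → s(x, y) ≠ s(z, w) → c s(x, y) ≠ c s(z, w)

open Classical in
/-- The number of colours used by an edge-colouring of `K_n`. -/
noncomputable def numColours (n : ℕ) (c : Sym2 (Fin n) → ℕ) : ℕ :=
  ((Finset.univ.filter (fun e : Sym2 (Fin n) => ¬ e.IsDiag)).image c).card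

/-- Colours appearing on edges inside `S`. -/
def colsIn {n : ℕ} (c : Sym2 (Fin n) → ℕ) (S : Finset (Fin n)) : Finset ℕ :=
  S.offDiag.image (fun p => c s(p.1, p.2))

theorem mem_colsIn {n : ℕ} (c : Sym2 (Fin n) → ℕ) (S : Finset (Fin n)) (k : ℕ) :
    k ∈ colsIn c S ↔ ∃ x ∈ S, ∃ y ∈ S, x ≠ y ∧ c s(x, y) = k := by
  unfold colsIn
  simp only [Finset.mem_image, Finset.mem_offDiag, Prod.exists]
  constructor
  · rintro ⟨a, b, ⟨h1, h2, h3⟩, h4⟩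
    exact ⟨a, h1, b, h2, h3, h4⟩
  · rintro ⟨a, h1, b, h2, h3, h4⟩
    exact ⟨a, b, ⟨h1, h2, h3⟩, h4⟩

/-- For each vertex, a set of leaves, one for each colour saturated at the vertex. -/
theorem exists_leaves {n : ℕ} (c : Sym2 (Fin n) → ℕ) (S : Finset (Fin n)) (v : Fin n) :
    ∃ N : Finset (Fin n), N.card = (colsIn c S \ colsIn c (S.erase v)).card ∧
      (∀ x ∈ N, x ∈ S ∧ x ≠ v ∧ c s(v, x) ∉ colsIn c (S.erase v)) ∧
      (∀ x ∈ N, ∀ y ∈ N, c s(v, x) = c s(v, y) → x = y) := by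
  have h : ∀ k ∈ colsIn c S \ colsIn c (S.erase v), ∃ x, x ∈ S ∧ x ≠ v ∧ c s(v, x) = k := by
    intro k hk
    rw [Finset.mem_sdiff] at hk
    obtain ⟨hk1, hk2⟩ := hk
    obtain ⟨x, hx, y, hy, hxy, hc⟩ := (mem_colsIn c S k).1 hk1
    by_cases hxv : x = v
    · subst hxv
      exact ⟨y, hy, hxy.symm, hc⟩
    · by_cases hyv : y = v
      · subst hyv
        exact ⟨x, hx, hxy, by rw [Sym2.eq_swap]; exact hc⟩
      · exact absurd ((mem_colsIn c _ k).2 ⟨x, Finset.mem_erase.2 ⟨hxv, hx⟩, y,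
          Finset.mem_erase.2 ⟨hyv, hy⟩, hxy, hc⟩) hk2
  have : Nonempty (Fin n) := ⟨v⟩
  choose! f hf using h
  refine ⟨(colsIn c S \ colsIn c (S.erase v)).image f, ?_, ?_, ?_⟩
  · apply Finset.card_image_of_injOn
    intro a ha b hb hab
    rw [← (hf a ha).2.2, ← (hf b hb).2.2, hab]
  · intro x hx
    obtain ⟨k, hk, rfl⟩ := Finset.mem_image.1 hx
    refine ⟨(hf k hk).1, (hf k hk).2.1, ?_⟩
    rw [(hf k hk).2.2]
    exact (Finset.mem_sdiff.1 hk).2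
  · intro x hx y hy hxy
    obtain ⟨k, hk, rfl⟩ := Finset.mem_image.1 hx
    obtain ⟨l, hl, rfl⟩ := Finset.mem_image.1 hy
    rw [(hf k hk).2.2, (hf l hl).2.2] at hxy
    rw [hxy]

theorem noRainbow_four {n : ℕ} (c : Sym2 (Fin n) → ℕ) (hr : NoRainbowK4 n c)
    (a b x y : Fin n) (hab : a ≠ b) (hax : a ≠ x) (hay : a ≠ y) (hbx : b ≠ x) (hby : b ≠ y)
    (hxy : x ≠ y)
    (h : [c s(a, b), c s(a, x), c s(a, y), c s(b, x), c s(b, y), c s(x, y)].Nodup) : False := by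
  apply hr
  refine ⟨{a, b, x, y}, ?_, ?_⟩
  · rw [Finset.card_insert_of_notMem, Finset.card_insert_of_notMem, Finset.card_pair hxy]
    · simp [hbx, hby]
    · simp [hab, hax, hay]
  · have e1 : s(b, a) = s(a, b) := Sym2.eq_swap
    have e2 : s(x, a) = s(a, x) := Sym2.eq_swap
    have e3 : s(y, a) = s(a, y) := Sym2.eq_swap
    have e4 : s(x, b) = s(b, x) := Sym2.eq_swap
    have e5 : s(y, b) = s(b, y) := Sym2.eq_swap
    have e6 : s(y, x) = s(x, y) := Sym2.eq_swap
    simp only [List.nodup_cons, List.mem_cons, List.not_mem_nil, or_false, not_or,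
      not_false_eq_true, List.nodup_nil, and_true] at h
    obtain ⟨⟨h1, h2, h3, h4, h5⟩, ⟨h6, h7, h8, h9⟩, ⟨h10, h11, h12⟩, ⟨h13, h14⟩, h15⟩ := h
    have key : ∀ p ∈ ({a, b, x, y} : Finset (Fin n)), ∀ q ∈ ({a, b, x, y} : Finset (Fin n)),
        p ≠ q → s(p, q) = s(a, b) ∨ s(p, q) = s(a, x) ∨ s(p, q) = s(a, y) ∨ s(p, q) = s(b, x) ∨
          s(p, q) = s(b, y) ∨ s(p, q) = s(x, y) := by
      intro p hp q hq hpq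
      simp only [Finset.mem_insert, Finset.mem_singleton] at hp hq
      rcases hp with rfl | rfl | rfl | rfl <;> rcases hq with rfl | rfl | rfl | rfl <;>
        first
        | exact absurd rfl hpq
        | simp only [e1, e2, e3, e4, e5, e6, true_or, or_true]
    intro p hp q hq z hz w hw hpq hzw hne
    have k1 := key p hp q hq hpq
    have k2 := key z hz w hw hzw
    clear key hpq hzw hp hq hz hw
    generalize s(p, q) = e at *
    generalize s(z, w) = f at *
    rcases k1 with rfl | rfl | rfl | rfl | rfl | rfl <;>
      rcases k2 with rfl | rfl | rfl | rfl | rfl | rfl <;>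
      first
      | exact absurd rfl hne
      | assumption
      | (apply Ne.symm; assumption)

theorem codegree_le {n m : ℕ} (hm : 3 ≤ m) (c : Sym2 (Fin n) → ℕ)
    (hmono : NoMonoClique n m c) (hrain : NoRainbowK4 n c) (S : Finset (Fin n))
    (N : Fin n → Finset (Fin n))
    (h1 : ∀ v, ∀ x ∈ N v, x ∈ S ∧ x ≠ v ∧ c s(v, x) ∉ colsIn c (S.erase v))
    (h2 : ∀ v, ∀ x ∈ N v, ∀ y ∈ N v, c s(v, x) = c s(v, y) → x = y)
    (v w : Fin n) (hv : v ∈ S) (hw : w ∈ S) (hvw : v ≠ w) : (N v ∩ N w).card ≤ m := by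
  by_contra! hcard
  -- colours at `v` and `w`
  have hA : ∀ x ∈ N v ∩ N w, ∀ p ∈ S, ∀ q ∈ S, p ≠ v → q ≠ v → p ≠ q →
      c s(v, x) ≠ c s(p, q) := by
    intro x hx p hp q hq hpv hqv hpq he
    refine (h1 v x (Finset.mem_inter.1 hx).1).2.2 ?_
    rw [he]
    exact (mem_colsIn _ _ _).2 ⟨p, Finset.mem_erase.2 ⟨hpv, hp⟩, q,
      Finset.mem_erase.2 ⟨hqv, hq⟩, hpq, rfl⟩
  have hB : ∀ x ∈ N v ∩ N w, ∀ p ∈ S, ∀ q ∈ S, p ≠ w → q ≠ w → p ≠ q →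
      c s(w, x) ≠ c s(p, q) := by
    intro x hx p hp q hq hpv hqv hpq he
    refine (h1 w x (Finset.mem_inter.1 hx).2).2.2 ?_
    rw [he]
    exact (mem_colsIn _ _ _).2 ⟨p, Finset.mem_erase.2 ⟨hpv, hp⟩, q,
      Finset.mem_erase.2 ⟨hqv, hq⟩, hpq, rfl⟩
  have hS : ∀ x ∈ N v ∩ N w, x ∈ S ∧ x ≠ v ∧ x ≠ w := by
    intro x hx
    have hx := Finset.mem_inter.1 hx
    exact ⟨(h1 v x hx.1).1, (h1 v x hx.1).2.1, (h1 w x hx.2).2.1⟩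
  -- the vertices to keep
  set Q := (N v ∩ N w).filter (fun x => c s(v, x) ≠ c s(v, w) ∧ c s(w, x) ≠ c s(v, w)) with hQ
  have hbad : ((N v ∩ N w).filter
      (fun x => ¬ (c s(v, x) ≠ c s(v, w) ∧ c s(w, x) ≠ c s(v, w)))).card ≤ 1 := by
    rw [Finset.card_le_one]
    intro x hx y hy
    rw [Finset.mem_filter] at hx hy
    obtain ⟨hx, hx'⟩ := hx
    obtain ⟨hy, hy'⟩ := hy
    have hx2 := Finset.mem_inter.1 hx
    have hy2 := Finset.mem_inter.1 hy
    obtain ⟨sx, sxv, sxw⟩ := hS x hx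
    obtain ⟨sy, syv, syw⟩ := hS y hy
    have k1 := hA x hx w hw y sy hvw.symm syv syw.symm
    have k2 := hA y hy w hw x sx hvw.symm sxv sxw.symm
    by_cases q1 : c s(v, x) = c s(v, w)
    · by_cases q2 : c s(v, y) = c s(v, w)
      · exact h2 v x hx2.1 y hy2.1 (q1.trans q2.symm)
      · by_cases q3 : c s(w, y) = c s(v, w)
        · exact absurd (q1.trans q3.symm) k1
        · exact absurd ⟨q2, q3⟩ hy'
    · by_cases q4 : c s(w, x) = c s(v, w)
      · by_cases q2 : c s(v, y) = c s(v, w)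
        · exact absurd (q2.trans q4.symm) k2
        · by_cases q3 : c s(w, y) = c s(v, w)
          · exact h2 w x hx2.2 y hy2.2 (q4.trans q3.symm)
          · exact absurd ⟨q2, q3⟩ hy'
      · exact absurd ⟨q1, q4⟩ hx'
  have hsum := Finset.card_filter_add_card_filter_not (s := N v ∩ N w)
    (fun x => c s(v, x) ≠ c s(v, w) ∧ c s(w, x) ≠ c s(v, w))
  have hQc : m ≤ Q.card := by
    rw [hQ]
    omega
  obtain ⟨R, hRQ, hRc⟩ := Finset.exists_subset_card_eq hQc
  apply hmono
  refine ⟨R, hRc, c s(v, w), ?_⟩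
  intro x hx y hy hxy
  have hx := Finset.mem_filter.1 (hRQ hx)
  have hy := Finset.mem_filter.1 (hRQ hy)
  by_contra hne
  obtain ⟨hx, hxa, hxb⟩ := hx
  obtain ⟨hy, hya, hyb⟩ := hy
  obtain ⟨sx, sxv, sxw⟩ := hS x hx
  obtain ⟨sy, syv, syw⟩ := hS y hy
  have hx2 := Finset.mem_inter.1 hx
  have hy2 := Finset.mem_inter.1 hy
  refine noRainbow_four c hrain v w x y hvw sxv.symm syv.symm sxw.symm syw.symm hxy ?_
  have t1 := hA x hx w hw y sy hvw.symm syv syw.symm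
  have t2 := hA y hy w hw x sx hvw.symm sxv sxw.symm
  have t3 := hA x hx w hw x sx hvw.symm sxv sxw.symm
  have t4 := hA y hy w hw y sy hvw.symm syv syw.symm
  have t5 := hA x hx x sx y sy sxv syv hxy
  have t6 := hA y hy x sx y sy sxv syv hxy
  have t7 := hB x hx x sx y sy sxw syw hxy
  have t8 := hB y hy x sx y sy sxw syw hxy
  have t9 : c s(v, x) ≠ c s(v, y) := fun h => hxy (h2 v x hx2.1 y hy2.1 h)
  have t10 : c s(w, x) ≠ c s(w, y) := fun h => hxy (h2 w x hx2.2 y hy2.2 h)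
  simp only [List.nodup_cons, List.mem_cons, List.not_mem_nil, or_false, not_or,
      not_false_eq_true, List.nodup_nil, and_true]
  exact ⟨⟨hxa.symm, hya.symm, hxb.symm, hyb.symm, fun h => hne h.symm⟩, ⟨t9, t3, t1, t5⟩,
    ⟨t2, t4, t6⟩, ⟨t10, t7⟩, t8⟩

theorem double_count {n m : ℕ} (S : Finset (Fin n)) (N : Fin n → Finset (Fin n))
    (hN : ∀ v, N v ⊆ S)
    (hco : ∀ v ∈ S, ∀ w ∈ S, v ≠ w → (N v ∩ N w).card ≤ m) :
    (∑ v ∈ S, (N v).card) ^ 2 ≤ S.card * (∑ v ∈ S, (N v).card + S.card * (S.card * m)) := by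
  classical
  have e1 : ∑ v ∈ S, (N v).card = ∑ x ∈ S, ∑ v ∈ S, if x ∈ N v then 1 else 0 := by
    rw [Finset.sum_comm]
    refine Finset.sum_congr rfl fun v _ => ?_
    rw [Finset.sum_ite_mem, Finset.inter_eq_right.2 (hN v)]
    simp
  have e2 : ∑ x ∈ S, (∑ v ∈ S, if x ∈ N v then 1 else 0) ^ 2
      = ∑ v ∈ S, ∑ w ∈ S, (N v ∩ N w).card := by
    simp_rw [pow_two, Finset.sum_mul_sum]
    rw [Finset.sum_comm]
    refine Finset.sum_congr rfl fun v _ => ?_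
    rw [Finset.sum_comm]
    refine Finset.sum_congr rfl fun w _ => ?_
    have : N v ∩ N w = S.filter (fun x => x ∈ N v ∧ x ∈ N w) := by
      ext x
      simp only [Finset.mem_inter, Finset.mem_filter]
      exact ⟨fun h => ⟨hN v h.1, h⟩, fun h => h.2⟩
    rw [this, Finset.card_filter]
    refine Finset.sum_congr rfl fun x _ => ?_
    by_cases a : x ∈ N v <;> by_cases b : x ∈ N w <;> simp [a, b]
  have e3 : ∑ v ∈ S, ∑ w ∈ S, (N v ∩ N w).card
      ≤ ∑ v ∈ S, ((N v).card + S.card * m) := by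
    refine Finset.sum_le_sum fun v hv => ?_
    rw [← Finset.add_sum_erase S _ hv, Finset.inter_self]
    refine Nat.add_le_add_left ?_ _
    calc ∑ w ∈ S.erase v, (N v ∩ N w).card ≤ ∑ w ∈ S.erase v, m :=
          Finset.sum_le_sum fun w hw => hco v hv w (Finset.mem_of_mem_erase hw)
            (Finset.ne_of_mem_erase hw).symm
      _ = (S.erase v).card * m := by simp
      _ ≤ S.card * m := Nat.mul_le_mul_right _ (Finset.card_le_card (Finset.erase_subset _ _))
  have e4 := sq_sum_le_card_mul_sum_sq (s := S)
    (f := fun x => ∑ v ∈ S, if x ∈ N v then 1 else 0)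
  rw [← e1, e2] at e4
  refine e4.trans (Nat.mul_le_mul_left _ (e3.trans ?_))
  rw [Finset.sum_add_distrib]
  simp

theorem exists_low {n m : ℕ} (hm : 3 ≤ m) (c : Sym2 (Fin n) → ℕ)
    (hmono : NoMonoClique n m c) (hrain : NoRainbowK4 n c) (S : Finset (Fin n))
    (hS : S.Nonempty) :
    ∃ v ∈ S, ((colsIn c S \ colsIn c (S.erase v)).card : ℝ) ≤ Real.sqrt (2 * m * S.card) := by
  by_contra! hcon
  choose N hN0 hN1 hN2 using exists_leaves c S
  have hdc := double_count (m := m) S N (fun v x hx => (hN1 v x hx).1)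
    (fun v hv w hw hvw => codegree_le hm c hmono hrain S N hN1 hN2 v w hv hw hvw)
  have hs : (1 : ℝ) ≤ S.card := by exact_mod_cast hS.card_pos
  have hm' : (3 : ℝ) ≤ m := by exact_mod_cast hm
  set r := Real.sqrt (2 * m * S.card) with hr
  have hr2 : r ^ 2 = 2 * m * S.card := Real.sq_sqrt (by positivity)
  have hr0 : 0 ≤ r := Real.sqrt_nonneg _
  have hT : (S.card : ℝ) * r < ((∑ v ∈ S, (N v).card : ℕ) : ℝ) := by
    push_cast
    rw [← nsmul_eq_mul, ← Finset.sum_const]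
    refine Finset.sum_lt_sum_of_nonempty hS fun v hv => ?_
    rw [hN0]
    exact hcon v hv
  have hdc' : ((∑ v ∈ S, (N v).card : ℕ) : ℝ) ^ 2
      ≤ S.card * (((∑ v ∈ S, (N v).card : ℕ) : ℝ) + S.card * (S.card * m)) := by
    exact_mod_cast hdc
  generalize ((∑ v ∈ S, (N v).card : ℕ) : ℝ) = T at *
  generalize (S.card : ℝ) = s at *
  have hr3 : 2 ≤ r := by nlinarith
  have hT2 : 2 * s ≤ T := by nlinarith
  have h1 : T ^ 2 ≤ 2 * (s * (s * (s * m))) := by nlinarith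
  have h2 : (s * r) ^ 2 < T ^ 2 := by
    apply pow_lt_pow_left₀ hT (by positivity) (by norm_num)
  have h3 : (s * r) ^ 2 = 2 * (s * (s * (s * m))) := by rw [mul_pow, hr2]; ring
  linarith

theorem cols_bound {n m : ℕ} (hm : 3 ≤ m) (c : Sym2 (Fin n) → ℕ)
    (hmono : NoMonoClique n m c) (hrain : NoRainbowK4 n c) (k : ℕ) :
    ∀ S : Finset (Fin n), S.card = k →
      ((colsIn c S).card : ℝ) ≤ k * Real.sqrt (2 * m * k) := by
  induction k with
  | zero =>
    intro S hS
    rw [Finset.card_eq_zero] at hS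
    subst hS
    simp [colsIn]
  | succ k ih =>
    intro S hS
    obtain ⟨v, hv, hle⟩ := exists_low hm c hmono hrain S
      (Finset.card_pos.1 (by omega))
    have hi := ih (S.erase v) (by rw [Finset.card_erase_of_mem hv]; omega)
    have hc : (colsIn c S).card ≤ (colsIn c S \ colsIn c (S.erase v)).card
        + (colsIn c (S.erase v)).card := by
      have := Finset.le_card_sdiff (colsIn c (S.erase v)) (colsIn c S)
      omega
    have hc' : ((colsIn c S).card : ℝ) ≤ (colsIn c S \ colsIn c (S.erase v)).card
        + (colsIn c (S.erase v)).card := by exact_mod_cast hc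
    rw [hS] at hle
    have hmon : Real.sqrt (2 * m * k) ≤ Real.sqrt (2 * m * ((k + 1 : ℕ) : ℝ)) := by
      apply Real.sqrt_le_sqrt
      push_cast
      nlinarith [Nat.cast_nonneg (α := ℝ) m]
    have := mul_le_mul_of_nonneg_left hmon (Nat.cast_nonneg (α := ℝ) k)
    have e : ((k + 1 : ℕ) : ℝ) * Real.sqrt (2 * m * ((k + 1 : ℕ) : ℝ))
      = k * Real.sqrt (2 * m * ((k + 1 : ℕ) : ℝ)) + Real.sqrt (2 * m * ((k + 1 : ℕ) : ℝ)) := by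
      push_cast
      ring
    linarith

theorem mixed_ramsey_upper (n m : ℕ) (hn : 1 ≤ n) (hm : 3 ≤ m)
    (c : Sym2 (Fin n) → ℕ)
    (hmono : NoMonoClique n m c) (hrain : NoRainbowK4 n c) :
    (numColours n c : ℝ) ≤ (n : ℝ) ^ ((3 : ℝ) / 2) * Real.sqrt (2 * m) := by
  have h := cols_bound hm c hmono hrain n Finset.univ (by simp)
  have h1 : numColours n c ≤ (colsIn c Finset.univ).card := by
    unfold numColours
    apply Finset.card_le_card
    intro k hk
    obtain ⟨e, he, rfl⟩ := Finset.mem_image.1 hk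
    have he := (Finset.mem_filter.1 he).2
    induction e with
    | _ x y =>
      exact (mem_colsIn _ _ _).2 ⟨x, Finset.mem_univ _, y, Finset.mem_univ _,
        fun h => he (Sym2.mk_isDiag_iff.2 h), rfl⟩
  have h1' : (numColours n c : ℝ) ≤ (colsIn c Finset.univ).card := by exact_mod_cast h1
  have hn0 : (0 : ℝ) < n := by exact_mod_cast hn
  have h2 : (n : ℝ) ^ ((3 : ℝ) / 2) = n * Real.sqrt n := by
    rw [show (3 : ℝ) / 2 = 1 + 1 / 2 by norm_num, Real.rpow_add hn0, Real.rpow_one,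
      Real.sqrt_eq_rpow]
  rw [h2]
  rw [Real.sqrt_mul (by positivity)] at h
  linarith [mul_assoc (n : ℝ) (Real.sqrt n) (Real.sqrt (2 * m)),
    mul_comm (Real.sqrt n) (Real.sqrt (2 * m))]
end

section
/- For every prime power q, the incidence graph L_q of the projective plane PG(2,q) contains a Hamilton cycle. -/
/-- The point–line incidence graph of the projective plane `PG(2,q)` built from a
3-dimensional vector space `K` over `F = GF(q)`: vertices are the 1-dimensional
subspaces (points) and the 2-dimensional subspaces (lines), with a point adjacent
to a line iff it is contained in it. -/
def IncidenceGraph (F K : Type*) [Field F] [AddCommGroup K] [Module F K] :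
    SimpleGraph ({P : Submodule F K // Module.finrank F P = 1} ⊕
      {L : Submodule F K // Module.finrank F L = 2}) :=
  SimpleGraph.fromRel (fun x y =>
    match x, y with
    | Sum.inl p, Sum.inr l => p.1 ≤ l.1
    | _, _ => False)

theorem hamiltonian_of_seq {V : Type*} [DecidableEq V] (G : SimpleGraph V) (M : ℕ) (hM : 3 ≤ M)
    (f : ℕ → V) (hadj : ∀ i, G.Adj (f i) (f (i + 1))) (hper : f M = f 0)
    (hinj : ∀ i < M, ∀ j < M, f i = f j → i = j) (hsurj : ∀ v, ∃ i < M, f i = v) :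
    ∃ (v : V) (w : G.Walk v v), w.IsHamiltonianCycle := by
  obtain ⟨n, rfl⟩ : ∃ n, M = n + 3 := ⟨M - 3, by omega⟩
  have key : ∀ u v : Fin (n + 3), (v - u).val = 1 → G.Adj (f u) (f v) := by
    intro u v h
    by_cases hle : u ≤ v
    · rw [Fin.sub_val_of_le hle] at h
      have hle' : u.val ≤ v.val := hle
      have : v.val = u.val + 1 := by omega
      rw [this]; exact hadj _
    · push Not at hle
      rw [Fin.coe_sub_iff_lt.mpr hle] at h
      have h1 := u.isLt
      have hv : v.val = 0 := by omega
      have hu : u.val + 1 = n + 3 := by omega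
      have := hadj u.val
      rw [hu, hper] at this
      rw [hv]; exact this
  let φ : SimpleGraph.cycleGraph (n + 3) →g G :=
    { toFun := fun i => f i.val
      map_rel' := by
        intro u v h
        rcases SimpleGraph.cycleGraph_adj'.mp h with h | h
        · exact (key _ _ h).symm
        · exact key _ _ h }
  have hbij : Function.Bijective φ := by
    constructor
    · intro u v h
      exact Fin.ext (hinj _ u.isLt _ v.isLt h)
    · intro v
      obtain ⟨i, hi, h⟩ := hsurj v
      exact ⟨⟨i, hi⟩, h⟩
  have hc : (SimpleGraph.cycleGraph.cycle n).IsHamiltonianCycle := by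
    rw [SimpleGraph.Walk.isHamiltonianCycle_iff_isCycle_and_length_eq]
    exact ⟨SimpleGraph.cycleGraph.isCycle_cycle, by simp⟩
  exact ⟨_, _, hc.map hbij⟩

section Singer

variable {F K : Type*} [Field F] [Field K] [Algebra F K]

/-- The point spanned by `g ^ k`. -/
def sPt (F : Type*) {K : Type*} [Field F] [Field K] [Algebra F K] (g : K) (k : ℕ) :
    Submodule F K := Submodule.span F {g ^ k}

/-- The line spanned by `g ^ k` and `g ^ (k+1)`. -/
def sLn (F : Type*) {K : Type*} [Field F] [Field K] [Algebra F K] (g : K) (k : ℕ) :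
    Submodule F K := sPt F g k ⊔ sPt F g (k + 1)

theorem sPt_le (g : K) (k : ℕ) (W : Submodule F K) : sPt F g k ≤ W ↔ g ^ k ∈ W := by
  simp [sPt, Submodule.span_le]

theorem finrank_sPt (g : K) (hg : g ≠ 0) (k : ℕ) : Module.finrank F (sPt F g k) = 1 :=
  finrank_span_singleton (pow_ne_zero k hg)

theorem finrank_sLn (g : K) (hg : g ≠ 0) (hgF : ∀ c : F, algebraMap F K c ≠ g) (k : ℕ) :
    Module.finrank F (sLn F g k) = 2 := by
  have hli : LinearIndependent F ![g ^ k, g ^ (k + 1)] := by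
    rw [LinearIndependent.pair_iff]
    intro s t h
    have h0 : algebraMap F K s + algebraMap F K t * g = 0 := by
      have h1 : g ^ k * (algebraMap F K s + algebraMap F K t * g) = 0 := by
        rw [← h, Algebra.smul_def, Algebra.smul_def]; ring
      exact (mul_eq_zero.mp h1).resolve_left (pow_ne_zero k hg)
    have ht : t = 0 := by
      by_contra ht
      apply hgF (-s / t)
      have ht' : algebraMap F K t ≠ 0 := by simpa using ht
      rw [map_div₀, map_neg, div_eq_iff ht']
      linear_combination -h0
    subst ht
    simpa using h0
  have : Module.finrank F (Submodule.span F (Set.range ![g ^ k, g ^ (k + 1)])) = 2 := by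
    rw [finrank_span_eq_card hli]; rfl
  rw [← this, sLn, sPt, sPt, ← Submodule.span_union]
  rw [Matrix.range_cons, Matrix.range_cons, Matrix.range_empty, Set.union_empty]

theorem finrank_inter (hdim : Module.finrank F K = 3) (g : K) (hg : g ≠ 0)
    (hgen : ∀ x : K, x ≠ 0 → ∃ n : ℕ, g ^ n = x)
    (W : Submodule F K) (hW : Module.finrank F W = 2) :
    Module.finrank F
      (W ⊓ W.comap (LinearMap.mulLeft F g) : Submodule F K) = 1 := by
  have : FiniteDimensional F K := FiniteDimensional.of_finrank_pos (by omega)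
  have hinj : Function.Injective (LinearMap.mulLeft F g) := fun a b h => by
    simpa [hg] using h
  let e : K ≃ₗ[F] K := LinearEquiv.ofInjectiveEndo (LinearMap.mulLeft F g) hinj
  have he : Module.finrank F (W.comap (LinearMap.mulLeft F g)) = 2 := by
    have h1 : W.comap (LinearMap.mulLeft F g) = W.map (e.symm : K →ₗ[F] K) := by
      rw [Submodule.map_equiv_eq_comap_symm]
      rfl
    rw [h1, LinearEquiv.finrank_map_eq, hW]
  have h1 := Submodule.finrank_sup_add_finrank_inf_eq W (W.comap (LinearMap.mulLeft F g))
  have h2 := Submodule.finrank_le (W ⊔ W.comap (LinearMap.mulLeft F g))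
  have h3 := Submodule.finrank_mono (inf_le_left : W ⊓ W.comap (LinearMap.mulLeft F g) ≤ W)
  have h4 : Module.finrank F (W ⊓ W.comap (LinearMap.mulLeft F g) : Submodule F K) ≠ 2 := by
    intro h
    have heq := Submodule.eq_of_le_of_finrank_eq
      (inf_le_left : W ⊓ W.comap (LinearMap.mulLeft F g) ≤ W) (by rw [h, hW])
    have hcl : ∀ x ∈ W, g * x ∈ W := by
      intro x hx
      rw [← heq] at hx
      exact hx.2
    have hcl2 : ∀ n : ℕ, ∀ x ∈ W, g ^ n * x ∈ W := by
      intro n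
      induction n with
      | zero => intro x hx; simpa using hx
      | succ n ih =>
        intro x hx
        have := hcl _ (ih x hx)
        rwa [← mul_assoc, ← pow_succ'] at this
    have hne : W ≠ ⊥ := by
      rintro rfl
      simp at hW
    obtain ⟨x, hx, hx0⟩ := Submodule.exists_mem_ne_zero_of_ne_bot hne
    have htop : W = ⊤ := by
      rw [Submodule.eq_top_iff']
      intro y
      by_cases hy : y = 0
      · rw [hy]; exact W.zero_mem
      · obtain ⟨n, hn⟩ := hgen (y / x) (div_ne_zero hy hx0)
        have := hcl2 n x hx
        rwa [hn, div_mul_cancel₀ _ hx0] at this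
    rw [htop, finrank_top] at hW
    omega
  omega

theorem sPt_mem_inter (g : K) (k : ℕ) (W : Submodule F K) (h : sLn F g k ≤ W) :
    sPt F g k ≤ W ⊓ W.comap (LinearMap.mulLeft F g) := by
  obtain ⟨h1, h2⟩ := sup_le_iff.mp h
  rw [sPt_le] at *
  refine ⟨h1, ?_⟩
  simpa [pow_succ'] using h2

theorem sPt_eq_iff (g : K) (hg : g ≠ 0) (i d : ℕ) :
    sPt F g (i + d) = sPt F g i ↔ ∃ c : F, algebraMap F K c = g ^ d := by
  constructor
  · intro h
    have : g ^ (i + d) ∈ sPt F g i := (sPt_le _ _ _).mp h.le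
    obtain ⟨c, hc⟩ := Submodule.mem_span_singleton.mp this
    refine ⟨c, ?_⟩
    rw [Algebra.smul_def, pow_add, mul_comm] at hc
    exact mul_left_cancel₀ (pow_ne_zero i hg) hc
  · rintro ⟨c, hc⟩
    have hc0 : c ≠ 0 := by
      rintro rfl
      rw [map_zero] at hc
      exact pow_ne_zero d hg hc.symm
    have : g ^ (i + d) = c • g ^ i := by
      rw [Algebra.smul_def, hc, pow_add, mul_comm]
    rw [sPt, sPt, this]
    exact Submodule.span_singleton_smul_eq (IsUnit.mk0 c hc0) _

end Singer

open Classical in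
theorem incidence_graph_hamiltonian (q : ℕ)
    (hq : ∃ p n : ℕ, p.Prime ∧ 0 < n ∧ q = p ^ n)
    (F K : Type*) [Field F] [Field K] [Algebra F K] [Fintype F]
    (hF : Fintype.card F = q) (hdim : Module.finrank F K = 3) :
    ∃ (v : ({P : Submodule F K // Module.finrank F P = 1} ⊕
        {L : Submodule F K // Module.finrank F L = 2}))
      (w : (IncidenceGraph F K).Walk v v), w.IsHamiltonianCycle := by
  have : FiniteDimensional F K := FiniteDimensional.of_finrank_pos (by omega)
  have : Finite K := Module.finite_of_finite F
  obtain ⟨u, hu⟩ := IsCyclic.exists_generator (α := Kˣ)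
  set g : K := (u : K) with hgdef
  have hg : g ≠ 0 := u.ne_zero
  have hgen : ∀ x : K, x ≠ 0 → ∃ n : ℕ, g ^ n = x := by
    intro x hx
    have h := hu (Units.mk0 x hx)
    rw [← mem_powers_iff_mem_zpowers] at h
    obtain ⟨n, hn⟩ := h
    refine ⟨n, ?_⟩
    have := congrArg Units.val hn
    simpa using this
  have hgF : ∀ c : F, algebraMap F K c ≠ g := by
    intro c hc
    have : Module.finrank F K ≤ 1 := by
      apply finrank_le_one (1 : K)
      intro x
      by_cases hx : x = 0
      · exact ⟨0, by simp [hx]⟩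
      · obtain ⟨n, hn⟩ := hgen x hx
        refine ⟨c ^ n, ?_⟩
        rw [Algebra.smul_def, map_pow, hc, hn, mul_one]
    omega
  have hex : ∃ n : ℕ, 0 < n ∧ ∃ c : F, algebraMap F K c = g ^ n := by
    refine ⟨orderOf u, orderOf_pos u, 1, ?_⟩
    have := congrArg Units.val (pow_orderOf_eq_one u)
    rw [Units.val_pow_eq_pow_val, Units.val_one] at this
    rw [map_one, hgdef, this]
  obtain ⟨N, ⟨hN0, hN⟩, hmin⟩ : ∃ N : ℕ, (0 < N ∧ ∃ c : F, algebraMap F K c = g ^ N) ∧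
      ∀ m < N, ¬ (0 < m ∧ ∃ c : F, algebraMap F K c = g ^ m) :=
    ⟨Nat.find hex, Nat.find_spec hex, fun m hm => Nat.find_min hex hm⟩
  have hN1 : N ≠ 1 := by
    rintro rfl
    obtain ⟨c, hc⟩ := hN
    exact hgF c (by simpa using hc)
  have hperP : Function.Periodic (sPt F g) N := fun i => (sPt_eq_iff g hg i N).mpr hN
  have hperL : Function.Periodic (sLn F g) N := fun i => by
    rw [sLn, sLn, hperP i, show i + N + 1 = (i + 1) + N by ring, hperP (i + 1)]
  have hinjP' : ∀ i j, i ≤ j → j < N → sPt F g i = sPt F g j → i = j := by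
    intro i j hij hj h
    obtain ⟨d, rfl⟩ := Nat.exists_eq_add_of_le hij
    have := (sPt_eq_iff g hg i d).mp h.symm
    by_contra hne
    exact hmin d (by omega) ⟨by omega, this⟩
  have hinjP : ∀ i < N, ∀ j < N, sPt F g i = sPt F g j → i = j := by
    intro i hi j hj h
    rcases le_total i j with hij | hij
    · exact hinjP' i j hij hj h
    · exact (hinjP' j i hij hi h.symm).symm
  have hfL := finrank_sLn (F := F) g hg hgF
  have hfP := finrank_sPt (F := F) g hg
  have hinjL : ∀ i < N, ∀ j < N, sLn F g i = sLn F g j → i = j := by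
    intro i hi j hj h
    have hD := finrank_inter hdim g hg hgen (sLn F g i) (hfL i)
    apply hinjP i hi j hj
    rw [Submodule.eq_of_le_of_finrank_eq (sPt_mem_inter g i (sLn F g i) le_rfl)
        (by rw [hD, hfP]),
      Submodule.eq_of_le_of_finrank_eq (sPt_mem_inter g j (sLn F g i) h.ge)
        (by rw [hD, hfP])]
  have hsurjP : ∀ W : Submodule F K, Module.finrank F W = 1 → ∃ i, sPt F g i = W := by
    intro W hW
    have hne : W ≠ ⊥ := by
      rintro rfl
      simp at hW
    obtain ⟨x, hx, hx0⟩ := Submodule.exists_mem_ne_zero_of_ne_bot hne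
    obtain ⟨n, rfl⟩ := hgen x hx0
    exact ⟨n, Submodule.eq_of_le_of_finrank_eq ((sPt_le _ _ _).mpr hx) (by rw [hW, hfP])⟩
  have hsurjL : ∀ W : Submodule F K, Module.finrank F W = 2 → ∃ i, sLn F g i = W := by
    intro W hW
    obtain ⟨n, hn⟩ := hsurjP _ (finrank_inter hdim g hg hgen W hW)
    refine ⟨n, Submodule.eq_of_le_of_finrank_eq ?_ (by rw [hW, hfL])⟩
    obtain ⟨h1, h2⟩ := (sPt_le g n _).mp hn.le
    refine sup_le ((sPt_le _ _ _).mpr h1) ((sPt_le _ _ _).mpr ?_)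
    simpa [pow_succ'] using h2
  let f : ℕ → ({P : Submodule F K // Module.finrank F P = 1} ⊕
        {L : Submodule F K // Module.finrank F L = 2}) := fun k =>
    if k % 2 = 0 then Sum.inl ⟨sPt F g (k / 2), hfP _⟩ else Sum.inr ⟨sLn F g (k / 2), hfL _⟩
  have hf0 : ∀ k, f (2 * k) = Sum.inl ⟨sPt F g k, hfP _⟩ := by
    intro k
    have h1 : 2 * k % 2 = 0 := by omega
    have h2 : 2 * k / 2 = k := by omega
    simp only [f, h1, h2, if_true]
  have hf1 : ∀ k, f (2 * k + 1) = Sum.inr ⟨sLn F g k, hfL _⟩ := by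
    intro k
    have h1 : ¬ ((2 * k + 1) % 2 = 0) := by omega
    have h2 : (2 * k + 1) / 2 = k := by omega
    simp only [f, h1, h2, if_false]
  clear_value f
  refine hamiltonian_of_seq (IncidenceGraph F K) (2 * N) (by omega) f ?_ ?_ ?_ ?_
  · intro i
    obtain ⟨k, rfl | rfl⟩ := Nat.even_or_odd' i
    · rw [hf0, hf1, IncidenceGraph, SimpleGraph.fromRel_adj]
      exact ⟨by simp, Or.inl le_sup_left⟩
    · rw [show 2 * k + 1 + 1 = 2 * (k + 1) by ring, hf0, hf1, IncidenceGraph,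
        SimpleGraph.fromRel_adj]
      exact ⟨by simp, Or.inr le_sup_right⟩
  · have := hf0 0
    rw [mul_zero] at this
    rw [hf0, this]
    have h := hperP 0
    rw [zero_add] at h
    simp only [h]
  · intro i hi j hj h
    obtain ⟨k, rfl | rfl⟩ := Nat.even_or_odd' i <;> obtain ⟨l, rfl | rfl⟩ := Nat.even_or_odd' j
    · rw [hf0, hf0] at h
      have := hinjP k (by omega) l (by omega) (by simpa using h)
      omega
    · rw [hf0, hf1] at h; simp at h
    · rw [hf0, hf1] at h; simp at h
    · rw [hf1, hf1] at h
      have := hinjL k (by omega) l (by omega) (by simpa using h)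
      omega
  · rintro (⟨W, hW⟩ | ⟨W, hW⟩)
    · obtain ⟨n, rfl⟩ := hsurjP W hW
      have := Nat.mod_lt n hN0
      refine ⟨2 * (n % N), by omega, ?_⟩
      rw [hf0]
      simp only [hperP.map_mod_nat]
    · obtain ⟨n, rfl⟩ := hsurjL W hW
      have := Nat.mod_lt n hN0
      refine ⟨2 * (n % N) + 1, by omega, ?_⟩
      rw [hf1]
      simp only [hperL.map_mod_nat]
end

section
/- For every prime power q, the incidence graph L_q of PG(2,q) admits a rotational Hamilton cycle: a Hamilton cycle v_0 v_1 … v_{n−1} (n = 2(q²+q+1)) such that v_i v_j ∈ E(L_q) if and only if v_{i+2} v_{j+2} ∈ E(L_q), indices modulo n. -/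
namespace RotHam

variable {F K : Type*} [Field F] [Field K] [Algebra F K] [Fintype F]

lemma mem_F_of_pow {x : Kˣ} (hx : x ^ (Fintype.card F - 1) = 1) [Finite K] :
    ∃ c : F, algebraMap F K c = x := by
  classical
  haveI := Fintype.ofFinite K
  set n := Fintype.card F - 1 with hn
  have hn0 : 0 < n := by have := Fintype.one_lt_card (α := F); omega
  let f : Fˣ →* Kˣ := Units.map (algebraMap F K).toMonoidHom
  have hf : Function.Injective f := Units.map_injective (algebraMap F K).injective
  have h1 : (Finset.univ.image f) ⊆ (Finset.univ.filter fun a : Kˣ => a ^ n = 1) := by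
    intro a ha
    obtain ⟨b, -, rfl⟩ := Finset.mem_image.1 ha
    simp only [Finset.mem_filter, Finset.mem_univ, true_and]
    rw [← map_pow, hn, ← Fintype.card_units, pow_card_eq_one, map_one]
  have h2 : (Finset.univ.filter fun a : Kˣ => a ^ n = 1).card ≤ (Finset.univ.image f).card := by
    rw [Finset.card_image_of_injective _ hf, Finset.card_univ, Fintype.card_units]
    exact IsCyclic.card_pow_eq_one_le hn0
  have h3 := Finset.eq_of_subset_of_card_le h1 h2
  have h4 : x ∈ Finset.univ.image f := by rw [h3]; simpa using hx
  obtain ⟨b, -, hb⟩ := Finset.mem_image.1 h4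
  exact ⟨b, by rw [← hb]; rfl⟩

lemma zpow_mem_iff [Finite K] (hdim : Module.finrank F K = 3) {g : Kˣ}
    (hg : ∀ x, x ∈ Subgroup.zpowers g) (k : ℤ) :
    (∃ c : F, algebraMap F K c = ((g ^ k : Kˣ) : K)) ↔
      (((Fintype.card F) ^ 2 + Fintype.card F + 1 : ℕ) : ℤ) ∣ k := by
  haveI := Fintype.ofFinite K
  have hq1 := Fintype.one_lt_card (α := F)
  set q := Fintype.card F with hq
  have hord : (orderOf g : ℤ) = ((q : ℤ) - 1) * ((q ^ 2 + q + 1 : ℕ) : ℤ) := by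
    rw [orderOf_eq_card_of_forall_mem_zpowers hg, Nat.card_units, Nat.card_eq_fintype_card,
      Module.card_eq_pow_finrank (K := F) (V := K), hdim, ← hq,
      Nat.cast_sub (Nat.one_le_pow _ _ (by omega))]
    push_cast; ring
  have hpow : (g ^ k) ^ (q - 1) = 1 ↔ ((q ^ 2 + q + 1 : ℕ) : ℤ) ∣ k := by
    rw [← zpow_natCast, ← zpow_mul, ← orderOf_dvd_iff_zpow_eq_one, hord,
      Nat.cast_sub hq1.le, mul_comm k]
    exact mul_dvd_mul_iff_left (by push_cast; omega)
  rw [← hpow]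
  constructor
  · rintro ⟨c, hc⟩
    have hc0 : c ≠ 0 := by
      rintro rfl
      exact (g ^ k).ne_zero (by rw [← hc, map_zero])
    ext
    rw [Units.val_pow_eq_pow_val, ← hc, ← map_pow, FiniteField.pow_card_sub_one_eq_one c hc0]
    simp
  · exact fun h => mem_F_of_pow h

lemma g_sq_not_mem [Finite K] (hdim : Module.finrank F K = 3) {g : Kˣ}
    (hg : ∀ x, x ∈ Subgroup.zpowers g) (c d : F) :
    (g : K) * g ≠ algebraMap F K c + algebraMap F K d * g := by
  intro h
  have hmem : ∀ n : ℕ, ∃ a b : F, (g : K) ^ n = algebraMap F K a + algebraMap F K b * g := by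
    intro n
    induction n with
    | zero => exact ⟨1, 0, by simp⟩
    | succ n ih =>
      obtain ⟨a, b, hab⟩ := ih
      refine ⟨b * c, a + b * d, ?_⟩
      rw [pow_succ, hab]
      simp only [map_add, map_mul]
      linear_combination (algebraMap F K b) * h
  have htop : Submodule.span F {(1 : K), (g : K)} = ⊤ := by
    rw [eq_top_iff]
    intro x _
    rw [Submodule.mem_span_pair]
    by_cases hx : x = 0
    · exact ⟨0, 0, by simp [hx]⟩
    · have := hg (Units.mk0 x hx)
      rw [← mem_powers_iff_mem_zpowers] at this
      obtain ⟨n, hn⟩ := this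
      obtain ⟨a, b, hab⟩ := hmem n
      refine ⟨a, b, ?_⟩
      have hx' : (g : K) ^ n = x := by
        have := congrArg Units.val hn
        simpa using this
      rw [← hx', hab, Algebra.smul_def, Algebra.smul_def, mul_one]
  classical
  have h3 : Module.finrank F (Submodule.span F {(1 : K), (g : K)}) = 3 := by
    rw [htop, finrank_top, hdim]
  have := finrank_span_finset_le_card (R := F) ({(1 : K), (g : K)} : Finset K)
  have h2 := Finset.card_le_two (a := (1 : K)) (b := (g : K))
  simp only [Finset.coe_insert, Finset.coe_singleton] at this
  rw [Set.finrank] at this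
  omega

lemma finrank_line [Finite K] (hdim : Module.finrank F K = 3) {g : Kˣ}
    (hg : ∀ x, x ∈ Subgroup.zpowers g) (x : Kˣ) :
    Module.finrank F (Submodule.span F {(x : K), (x : K) * g}) = 2 := by
  have hli : LinearIndependent F ![(x : K), (x : K) * g] := by
    rw [LinearIndependent.pair_iff]
    intro s t hst
    rw [Algebra.smul_def, Algebra.smul_def] at hst
    have h0 : algebraMap F K s + algebraMap F K t * g = 0 := by
      have : (x : K) * (algebraMap F K s + algebraMap F K t * g) = 0 := by
        linear_combination hst
      exact (mul_eq_zero.1 this).resolve_left x.ne_zero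
    by_cases ht : t = 0
    · subst ht
      refine ⟨?_, rfl⟩
      simpa using h0
    · exfalso
      have ht' : algebraMap F K t ≠ 0 := by simpa using ht
      have h1 : (g : K) = algebraMap F K (-s / t) := by
        rw [map_div₀, map_neg, eq_div_iff ht']
        linear_combination h0
      refine g_sq_not_mem hdim hg 0 (-s/t) ?_
      rw [← h1]; simp
  have := finrank_span_eq_card hli
  rw [Matrix.range_cons, Matrix.range_cons, Matrix.range_empty, Set.union_empty,
    Set.singleton_union] at this
  simpa using this

/-- points -/
def pt (g : Kˣ) (k : ℤ) : {P : Submodule F K // Module.finrank F P = 1} :=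
  ⟨Submodule.span F {((g ^ k : Kˣ) : K)}, finrank_span_singleton (g ^ k).ne_zero⟩

/-- lines -/
def ln [Finite K] (hdim : Module.finrank F K = 3) {g : Kˣ}
    (hg : ∀ x, x ∈ Subgroup.zpowers g) (k : ℤ) :
    {L : Submodule F K // Module.finrank F L = 2} :=
  ⟨Submodule.span F {((g ^ k : Kˣ) : K), ((g ^ k : Kˣ) : K) * g}, finrank_line hdim hg _⟩

lemma zval (g : Kˣ) (k l : ℤ) : ((g ^ k : Kˣ) : K) = ((g ^ (k - l) : Kˣ) : K) * ((g ^ l : Kˣ) : K) := by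
  rw [← Units.val_mul, ← zpow_add, sub_add_cancel]

lemma pt_eq [Finite K] (hdim : Module.finrank F K = 3) {g : Kˣ}
    (hg : ∀ x, x ∈ Subgroup.zpowers g) (k l : ℤ) :
    (pt g k : {P : Submodule F K // Module.finrank F P = 1}) = pt g l ↔
      (((Fintype.card F) ^ 2 + Fintype.card F + 1 : ℕ) : ℤ) ∣ k - l := by
  rw [← zpow_mem_iff hdim hg]
  constructor
  · intro h
    have h1 : ((g ^ k : Kˣ) : K) ∈ (pt g l : {P : Submodule F K // Module.finrank F P = 1}).1 := by
      rw [← h]; exact Submodule.mem_span_singleton_self _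
    obtain ⟨c, hc⟩ := Submodule.mem_span_singleton.1 h1
    refine ⟨c, ?_⟩
    rw [Algebra.smul_def, zval g k l] at hc
    exact mul_right_cancel₀ (g ^ l).ne_zero hc
  · rintro ⟨c, hc⟩
    apply Subtype.ext
    have hc0 : c ≠ 0 := by
      rintro rfl
      exact (g ^ (k-l)).ne_zero (by rw [← hc, map_zero])
    change Submodule.span F {_} = Submodule.span F {_}
    rw [zval g k l, ← hc, ← Algebra.smul_def]
    exact Submodule.span_singleton_smul_eq (IsUnit.mk0 c hc0) _

lemma ln_le [Finite K] (hdim : Module.finrank F K = 3) {g : Kˣ}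
    (hg : ∀ x, x ∈ Subgroup.zpowers g) (k : ℤ) (L : {L : Submodule F K // Module.finrank F L = 2})
    (h1 : ((g ^ k : Kˣ) : K) ∈ L.1) (h2 : ((g ^ k : Kˣ) : K) * g ∈ L.1) : ln hdim hg k = L := by
  haveI : FiniteDimensional F K := Module.finite_of_finrank_pos (by omega)
  apply Subtype.ext
  apply Submodule.eq_of_le_of_finrank_eq
  · refine Submodule.span_le.2 ?_
    rintro x (rfl | rfl)
    · exact h1
    · exact h2
  · rw [(ln hdim hg k).2, L.2]

lemma mem_ln [Finite K] (hdim : Module.finrank F K = 3) {g : Kˣ}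
    (hg : ∀ x, x ∈ Subgroup.zpowers g) (k l : ℤ) (y : K) :
    ((g ^ k : Kˣ) : K) * y ∈ (ln hdim hg l).1 ↔
      ∃ a b : F, ((g ^ (k - l) : Kˣ) : K) * y = algebraMap F K a + algebraMap F K b * g := by
  change _ ∈ Submodule.span F {_, _} ↔ _
  rw [Submodule.mem_span_pair]
  refine exists_congr fun a => exists_congr fun b => ?_
  rw [Algebra.smul_def, Algebra.smul_def, zval g k l, eq_comm]
  constructor
  · intro h
    apply mul_left_cancel₀ (g ^ l).ne_zero
    linear_combination h
  · intro h
    linear_combination ((g ^ l : Kˣ) : K) * h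

lemma ln_eq [Finite K] (hdim : Module.finrank F K = 3) {g : Kˣ}
    (hg : ∀ x, x ∈ Subgroup.zpowers g) (k l : ℤ) :
    ln hdim hg k = ln hdim hg l ↔
      (((Fintype.card F) ^ 2 + Fintype.card F + 1 : ℕ) : ℤ) ∣ k - l := by
  rw [← zpow_mem_iff hdim hg]
  constructor
  · intro h
    have h1 : ((g ^ k : Kˣ) : K) * 1 ∈ (ln hdim hg l).1 := by
      rw [← h, mul_one]; exact Submodule.subset_span (by simp)
    have h2 : ((g ^ k : Kˣ) : K) * g ∈ (ln hdim hg l).1 := by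
      rw [← h]; exact Submodule.subset_span (by simp)
    rw [mem_ln] at h1 h2
    obtain ⟨a, b, h1⟩ := h1
    obtain ⟨c, d, h2⟩ := h2
    rw [mul_one] at h1
    rw [h1] at h2 ⊢
    by_cases hb : b = 0
    · exact ⟨a, by simp [hb]⟩
    · exfalso
      have hb' : algebraMap F K b ≠ 0 := by simpa using hb
      apply g_sq_not_mem hdim hg (c / b) ((d - a) / b)
      simp only [map_div₀, map_sub]
      field_simp
      linear_combination h2
  · rintro ⟨c, hc⟩
    apply ln_le
    · rw [← mul_one ((g ^ k : Kˣ) : K), mem_ln]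
      exact ⟨c, 0, by rw [hc]; simp⟩
    · rw [mem_ln]
      exact ⟨0, c, by rw [hc]; simp⟩

lemma pt_surj {g : Kˣ} (hg : ∀ x, x ∈ Subgroup.zpowers g)
    (P : {P : Submodule F K // Module.finrank F P = 1}) : ∃ k, pt g k = P := by
  obtain ⟨P, hP⟩ := P
  obtain ⟨v, hv, h⟩ := finrank_eq_one_iff'.1 hP
  have hv' : (v : K) ≠ 0 := by simpa using hv
  obtain ⟨k, hk⟩ := hg (Units.mk0 (v : K) hv')
  have hk' : ((g ^ k : Kˣ) : K) = v := congrArg Units.val hk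
  refine ⟨k, Subtype.ext ?_⟩
  change Submodule.span F {_} = P
  rw [hk']
  apply le_antisymm
  · rw [Submodule.span_singleton_le_iff_mem]; exact v.2
  · intro w hw
    obtain ⟨c, hc⟩ := h ⟨w, hw⟩
    exact Submodule.mem_span_singleton.2 ⟨c, congrArg Subtype.val hc⟩

lemma ln_surj [Finite K] (hdim : Module.finrank F K = 3) {g : Kˣ}
    (hg : ∀ x, x ∈ Subgroup.zpowers g)
    (L : {L : Submodule F K // Module.finrank F L = 2}) : ∃ k, ln hdim hg k = L := by
  haveI : FiniteDimensional F K := Module.finite_of_finrank_pos (by omega)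
  let e : K →ₗ[F] K := LinearMap.mulRight F (g : K)
  have he : Function.Injective e := mul_left_injective₀ g.ne_zero
  have hM : Module.finrank F (L.1.map e) = 2 := by
    exact (LinearEquiv.finrank_eq (Submodule.equivMapOfInjective e he L.1)).symm.trans L.2
  have h1 := Submodule.finrank_sup_add_finrank_inf_eq (L.1.map e) L.1
  have h2 := Submodule.finrank_le (L.1.map e ⊔ L.1)
  have h3 : (L.1.map e ⊓ L.1) ≠ ⊥ := by
    intro h
    rw [h, finrank_bot, hM, L.2] at h1
    omega
  obtain ⟨y, ⟨⟨x, hx, rfl⟩, hy⟩, hy0⟩ := Submodule.exists_mem_ne_zero_of_ne_bot h3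
  have hx0 : x ≠ 0 := by rintro rfl; simp at hy0
  obtain ⟨k, hk⟩ := hg (Units.mk0 x hx0)
  have hk' : ((g ^ k : Kˣ) : K) = x := congrArg Units.val hk
  refine ⟨k, ln_le _ _ _ _ ?_ ?_⟩
  · rw [hk']; exact hx
  · rw [hk']; exact hy

lemma adj_inl_inr (p : {P : Submodule F K // Module.finrank F P = 1})
    (l : {L : Submodule F K // Module.finrank F L = 2}) :
    (IncidenceGraph F K).Adj (Sum.inl p) (Sum.inr l) ↔ p.1 ≤ l.1 := by
  simp [IncidenceGraph]

lemma adj_inl_inl (p p' : {P : Submodule F K // Module.finrank F P = 1}) :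
    ¬ (IncidenceGraph F K).Adj (Sum.inl p) (Sum.inl p') := by
  simp [IncidenceGraph]

lemma adj_inr_inr (p p' : {P : Submodule F K // Module.finrank F P = 2}) :
    ¬ (IncidenceGraph F K).Adj (Sum.inr p) (Sum.inr p') := by
  simp [IncidenceGraph]

lemma pt_le_ln [Finite K] (hdim : Module.finrank F K = 3) {g : Kˣ}
    (hg : ∀ x, x ∈ Subgroup.zpowers g) (k l : ℤ) :
    (pt g k : {P : Submodule F K // Module.finrank F P = 1}).1 ≤ (ln hdim hg l).1 ↔
      ∃ a b : F, ((g ^ (k - l) : Kˣ) : K) = algebraMap F K a + algebraMap F K b * g := by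
  have := mem_ln hdim hg k l 1
  simp only [mul_one] at this
  rw [← this]
  exact Submodule.span_singleton_le_iff_mem _ _

/-- the cycle, indexed by integers -/
def w [Finite K] (hdim : Module.finrank F K = 3) {g : Kˣ}
    (hg : ∀ x, x ∈ Subgroup.zpowers g) (m : ℤ) :
    {P : Submodule F K // Module.finrank F P = 1} ⊕
          {L : Submodule F K // Module.finrank F L = 2} :=
  if m % 2 = 0 then Sum.inl (pt g (m / 2)) else Sum.inr (ln hdim hg (m / 2))

lemma w_even [Finite K] (hdim : Module.finrank F K = 3) {g : Kˣ}
    (hg : ∀ x, x ∈ Subgroup.zpowers g) (k : ℤ) : w hdim hg (2 * k) = Sum.inl (pt g k) := by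
  rw [w, if_pos (by omega)]; congr 2; omega

lemma w_odd [Finite K] (hdim : Module.finrank F K = 3) {g : Kˣ}
    (hg : ∀ x, x ∈ Subgroup.zpowers g) (k : ℤ) :
    w hdim hg (2 * k + 1) = Sum.inr (ln hdim hg k) := by
  rw [w, if_neg (by omega)]; congr 2; omega

lemma w_eq [Finite K] (hdim : Module.finrank F K = 3) {g : Kˣ}
    (hg : ∀ x, x ∈ Subgroup.zpowers g) (m m' : ℤ) :
    w hdim hg m = w hdim hg m' ↔
      ((2 * ((Fintype.card F) ^ 2 + Fintype.card F + 1) : ℕ) : ℤ) ∣ m - m' := by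
  have key : ∀ a b : ℤ, (((Fintype.card F) ^ 2 + Fintype.card F + 1 : ℕ) : ℤ) ∣ a - b ↔
      ((2 * ((Fintype.card F) ^ 2 + Fintype.card F + 1) : ℕ) : ℤ) ∣ 2 * a - 2 * b := by
    intro a b
    rw [Nat.cast_mul, ← mul_sub]
    exact (mul_dvd_mul_iff_left (by norm_num)).symm
  have odd : ∀ a : ℤ, ((2 * ((Fintype.card F) ^ 2 + Fintype.card F + 1) : ℕ) : ℤ) ∣ a → 2 ∣ a := by
    intro a ha
    rw [Nat.cast_mul] at ha
    exact (dvd_mul_right _ _).trans ha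
  rcases Int.even_or_odd' m with ⟨k, rfl | rfl⟩ <;> rcases Int.even_or_odd' m' with ⟨l, rfl | rfl⟩
  · rw [w_even, w_even, Sum.inl.injEq, pt_eq hdim hg, key]
  · rw [w_even, w_odd]
    refine ⟨fun h => by simp at h, fun h => ?_⟩
    have := odd _ h; omega
  · rw [w_even, w_odd]
    refine ⟨fun h => by simp at h, fun h => ?_⟩
    have := odd _ h; omega
  · rw [w_odd, w_odd, Sum.inr.injEq, ln_eq, key, add_sub_add_right_eq_sub]

lemma w_adj_succ [Finite K] (hdim : Module.finrank F K = 3) {g : Kˣ}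
    (hg : ∀ x, x ∈ Subgroup.zpowers g) (m : ℤ) :
    (IncidenceGraph F K).Adj (w hdim hg m) (w hdim hg (m + 1)) := by
  rcases Int.even_or_odd' m with ⟨k, rfl | rfl⟩
  · rw [w_even, w_odd, adj_inl_inr, pt_le_ln]
    exact ⟨1, 0, by simp⟩
  · rw [w_odd, show 2 * k + 1 + 1 = 2 * (k + 1) by ring, w_even, SimpleGraph.adj_comm,
      adj_inl_inr, pt_le_ln]
    exact ⟨0, 1, by simp⟩

lemma w_adj_shift [Finite K] (hdim : Module.finrank F K = 3) {g : Kˣ}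
    (hg : ∀ x, x ∈ Subgroup.zpowers g) (m m' : ℤ) :
    (IncidenceGraph F K).Adj (w hdim hg m) (w hdim hg m') ↔
    (IncidenceGraph F K).Adj (w hdim hg (m + 2)) (w hdim hg (m' + 2)) := by
  have e1 : ∀ k : ℤ, 2 * k + 2 = 2 * (k + 1) := fun k => by ring
  have e2 : ∀ k : ℤ, 2 * k + 1 + 2 = 2 * (k + 1) + 1 := fun k => by ring
  rcases Int.even_or_odd' m with ⟨k, rfl | rfl⟩ <;> rcases Int.even_or_odd' m' with ⟨l, rfl | rfl⟩
  · simp only [e1, w_even, adj_inl_inl]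
  · simp only [e1, e2, w_even, w_odd, adj_inl_inr, pt_le_ln, add_sub_add_right_eq_sub]
  · rw [SimpleGraph.adj_comm, SimpleGraph.adj_comm _ (w hdim hg (2 * k + 1 + 2))]
    simp only [e1, e2, w_even, w_odd, adj_inl_inr, pt_le_ln, add_sub_add_right_eq_sub]
  · simp only [e2, w_odd, adj_inr_inr]

lemma w_surj [Finite K] (hdim : Module.finrank F K = 3) {g : Kˣ}
    (hg : ∀ x, x ∈ Subgroup.zpowers g) : Function.Surjective (w hdim hg) := by
  rintro (P | L)
  · obtain ⟨k, rfl⟩ := pt_surj hg P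
    exact ⟨2 * k, w_even _ _ _⟩
  · obtain ⟨k, rfl⟩ := ln_surj hdim hg L
    exact ⟨2 * k + 1, w_odd _ _ _⟩

end RotHam

/-- A rotational Hamilton cycle: a cyclic ordering `v_0, …, v_{n-1}` of all vertices
(`n = 2(q²+q+1)`), consecutive vertices adjacent, such that the shift of indices
by 2 preserves adjacency. -/
theorem incidence_graph_rotational_hamiltonian (q : ℕ)
    (hq : ∃ p n : ℕ, p.Prime ∧ 0 < n ∧ q = p ^ n)
    (F K : Type*) [Field F] [Field K] [Algebra F K] [Fintype F]
    (hF : Fintype.card F = q) (hdim : Module.finrank F K = 3) :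
    ∃ v : ZMod (2 * (q ^ 2 + q + 1)) →
        ({P : Submodule F K // Module.finrank F P = 1} ⊕
          {L : Submodule F K // Module.finrank F L = 2}),
      Function.Bijective v ∧
      (∀ i, (IncidenceGraph F K).Adj (v i) (v (i + 1))) ∧
      (∀ i j, (IncidenceGraph F K).Adj (v i) (v j) ↔
        (IncidenceGraph F K).Adj (v (i + 2)) (v (j + 2))) := by
  subst hF
  haveI : FiniteDimensional F K := Module.finite_of_finrank_pos (by omega)
  haveI : Finite K := Module.finite_of_finite F
  obtain ⟨g, hg⟩ := IsCyclic.exists_generator (α := Kˣ)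
  set N := 2 * ((Fintype.card F) ^ 2 + Fintype.card F + 1) with hN
  have hv : ∀ (i : ZMod N) (m : ℤ), (m : ZMod N) = i →
      RotHam.w hdim hg (ZMod.cast i : ℤ) = RotHam.w hdim hg m := by
    rintro i m rfl
    rw [RotHam.w_eq, ← hN, ← ZMod.intCast_eq_intCast_iff_dvd_sub, ZMod.intCast_zmod_cast]
  refine ⟨fun i => RotHam.w hdim hg (ZMod.cast i : ℤ), ⟨?_, ?_⟩, ?_, ?_⟩
  · intro i j hij
    simp only [RotHam.w_eq] at hij
    rw [← hN, ← ZMod.intCast_eq_intCast_iff_dvd_sub] at hij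
    simpa using hij.symm
  · intro x
    obtain ⟨m, rfl⟩ := RotHam.w_surj hdim hg x
    exact ⟨(m : ZMod N), hv _ m rfl⟩
  · intro i
    simp only
    rw [hv (i + 1) ((ZMod.cast i : ℤ) + 1) (by simp)]
    exact RotHam.w_adj_succ hdim hg _
  · intro i j
    simp only
    rw [hv (i + 2) ((ZMod.cast i : ℤ) + 2) (by simp), hv (j + 2) ((ZMod.cast j : ℤ) + 2) (by simp)]
    exact RotHam.w_adj_shift hdim hg _ _
end
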